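/- arXiv:1507.06091 — 2 statements merged into one kernel-verified Lean document; each statement's English description precedes it below -/
import Mathlib

section
/- For every L > 0, every n ∈ ℕ, and every ε > 0, there exists δ > 0 with the following property. Let B and C be unital C*-algebras, let π : B → C be a surjective unital *-homomorphism, and let x_1, …, x_n ∈ B be contractions. If u : [0,1] → C is a continuous path of unitaries in C with u 0 = 1, whose total variation (rectifiable length) on [0,1] is at most L, and which satisfies ‖π(x_i) · (u t) − (u t) · π(x_i)‖ < δ for all i = 1, …, n and all t ∈ [0,1], then there exists a continuous path v : [0,1] → B of unitaries in B with π(v t) = u t for all t ∈ [0,1] and ‖x_i · (v t) − (v t) · x_i‖ < ε for all i = 1, …, n and all t ∈ [0,1]. -/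
open Filter Topology

theorem exists_filter_approximateUnit_ker {A D : Type*} [CStarAlgebra A] [CStarAlgebra D]
    (π : A →⋆ₐ[ℂ] D) :
    ∃ l : Filter A, l.NeBot ∧ (∀ᶠ e in l, π e = 0 ∧ IsSelfAdjoint e ∧ ‖e‖ ≤ 1) ∧
      ∀ a, π a = 0 → Tendsto (fun e => a * e) l (𝓝 a) ∧ Tendsto (fun e => e * a) l (𝓝 a) := by
  let J : NonUnitalStarSubalgebra ℂ A := NonUnitalStarSubalgebra.comap π ⊥
  have hJ (a : A) : a ∈ J ↔ π a = 0 := by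
    simp only [J, NonUnitalStarSubalgebra.mem_comap, NonUnitalStarAlgebra.mem_bot]
  have hcont : Continuous π := (NonUnitalStarAlgHom.instContinuousLinearMapClassComplex
    (F := A →⋆ₐ[ℂ] D)).map_continuous π
  have : IsClosed (J : Set A) := by
    have : (J : Set A) = π ⁻¹' {0} := by ext a; exact hJ a
    rw [this]
    exact isClosed_singleton.preimage hcont
  let _ : PartialOrder J := CStarAlgebra.spectralOrder J
  have : StarOrderedRing J := CStarAlgebra.spectralOrderedRing J
  have hu := CStarAlgebra.increasingApproximateUnit J
  refine ⟨(CStarAlgebra.approximateUnit J).map Subtype.val, inferInstance, ?_, fun a ha => ?_⟩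
  · rw [eventually_map]
    filter_upwards [hu.eventually_norm, hu.eventually_isSelfAdjoint] with e he he'
    exact ⟨(hJ _).1 e.2, congrArg Subtype.val he', he⟩
  · rw [tendsto_map'_iff, tendsto_map'_iff]
    have h1 := hu.tendsto_mul_left ⟨a, (hJ a).2 ha⟩
    have h2 := hu.tendsto_mul_right ⟨a, (hJ a).2 ha⟩
    exact ⟨(continuous_subtype_val.tendsto _).comp h1, (continuous_subtype_val.tendsto _).comp h2⟩

/-- Every `p` with `‖π p‖ ≤ c` is within `c` of the kernel of `π`, if `p` is selfadjoint. -/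
theorem IsSelfAdjoint.exists_mem_ker_norm_sub_le {A D : Type*} [CStarAlgebra A] [CStarAlgebra D]
    (π : A →⋆ₐ[ℂ] D) {p : A} (hp : IsSelfAdjoint p) {c : ℝ} (hc : ‖π p‖ ≤ c) :
    ∃ q : A, π q = 0 ∧ ‖p - q‖ ≤ c := by
  have hc0 : 0 ≤ c := (norm_nonneg _).trans hc
  have hcont : Continuous π := (NonUnitalStarAlgHom.instContinuousLinearMapClassComplex
    (F := A →⋆ₐ[ℂ] D)).map_continuous π
  refine ⟨cfc (fun t : ℝ => t - max (-c) (min t c)) p, ?_, ?_⟩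
  · have hπp : IsSelfAdjoint (π p) := hp.map π
    rw [StarAlgHomClass.map_cfc π _ p (S := ℂ) (by fun_prop) hcont hp hπp, ← norm_le_zero_iff]
    refine norm_cfc_le le_rfl fun t ht => ?_
    have htc : |t| ≤ c := by
      rcases subsingleton_or_nontrivial D with _ | _
      · simp [spectrum.of_subsingleton] at ht
      · exact (spectrum.norm_le_norm_of_mem ht).trans hc
    rw [abs_le] at htc
    rw [min_eq_left htc.2, max_eq_right htc.1]
    simp
  · nth_rewrite 1 [← cfc_id' ℝ p]
    rw [← cfc_sub ..]
    refine norm_cfc_le hc0 fun t _ => ?_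
    rw [sub_sub_cancel, Real.norm_eq_abs, abs_le]
    exact ⟨le_max_left _ _, max_le (by linarith) (min_le_right _ _)⟩

theorem eventually_norm_one_sub_mul_le {A D : Type*} [CStarAlgebra A] [CStarAlgebra D]
    (π : A →⋆ₐ[ℂ] D) {l : Filter A} (hl : ∀ᶠ e in l, π e = 0 ∧ IsSelfAdjoint e ∧ ‖e‖ ≤ 1)
    (hl' : ∀ a, π a = 0 → Tendsto (fun e => e * a) l (𝓝 a)) (y : A) {η : ℝ} (hη : 0 < η) :
    ∀ᶠ e in l, ‖(1 - e) * y‖ ≤ 2 * ‖π y‖ + η := by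
  obtain ⟨q, hq, hq'⟩ := (IsSelfAdjoint.mul_star_self y).exists_mem_ker_norm_sub_le π
    (c := ‖π y‖ ^ 2) (by rw [map_mul, map_star, CStarRing.norm_self_mul_star, sq])
  have hlim : Tendsto (fun e => (1 - e) * q) l (𝓝 0) := by
    simpa [sub_mul] using (tendsto_const_nhds (x := q)).sub (hl' q hq)
  have hsmall : ∀ᶠ e in l, ‖(1 - e) * q‖ < η ^ 2 / 2 := by
    have := hlim.norm
    rw [norm_zero] at this
    exact this.eventually_lt_const (by positivity)
  filter_upwards [hl, hsmall] with e ⟨_, hsa, he⟩ hsm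
  have h2 : ‖1 - e‖ ≤ 2 := by
    have : ‖(1 : A)‖ ≤ 1 := by
      nontriviality A
      exact CStarRing.norm_one.le
    linarith [norm_sub_le (1 : A) e]
  have hst : star (1 - e) = 1 - e := by rw [star_sub, star_one, hsa.star_eq]
  have key : ‖(1 - e) * y‖ ^ 2 ≤ (2 * ‖π y‖ + η) ^ 2 := by
    calc ‖(1 - e) * y‖ ^ 2 = ‖(1 - e) * (y * star y - q) * (1 - e) + (1 - e) * q * (1 - e)‖ := by
          rw [sq, ← CStarRing.norm_self_mul_star, star_mul, hst]
          congr 1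
          noncomm_ring
      _ ≤ ‖1 - e‖ * ‖y * star y - q‖ * ‖1 - e‖ + ‖(1 - e) * q‖ * ‖1 - e‖ :=
          (norm_add_le _ _).trans (add_le_add (norm_mul₃_le ..) (norm_mul_le _ _))
      _ ≤ 2 * ‖π y‖ ^ 2 * 2 + η ^ 2 / 2 * 2 := by gcongr
      _ ≤ (2 * ‖π y‖ + η) ^ 2 := by nlinarith [norm_nonneg (π y)]
  exact abs_le_of_sq_le_sq' key (by positivity) |>.2

theorem exists_sum_almost_commute {A D : Type*} [CStarAlgebra A] [CStarAlgebra D]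
    (π : A →⋆ₐ[ℂ] D) {n : ℕ} (x y : Fin n → A) (hx : ∀ i, ‖x i‖ ≤ 1) {η : ℝ} (hη : 0 < η) (m : ℕ) :
    ∃ E : A, π E = 0 ∧ IsSelfAdjoint E ∧ ‖E‖ ≤ m ∧ ∀ i, ‖x i * E - E * x i‖ ^ 2 ≤ 5 * m ∧
      ‖((m : A) - E) * y i‖ ≤ m * (2 * ‖π (y i)‖ + η) := by
  obtain ⟨l, hne, hl, hlim⟩ := exists_filter_approximateUnit_ker π
  induction m with
  | zero => exact ⟨0, by simp⟩
  | succ m ih =>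
    obtain ⟨E, hE, hEsa, hEn, hEi⟩ := ih
    have h1 : ∀ᶠ e in l, ∀ i, ‖(1 - e) * y i‖ ≤ 2 * ‖π (y i)‖ + η :=
      eventually_all.2 fun i => eventually_norm_one_sub_mul_le π hl (fun a ha => (hlim a ha).2) _ hη
    have h2 : ∀ᶠ e in l, ∀ i, ‖star (x i * E - E * x i) * (x i * e - e * x i)‖ < 1 / 2 := by
      refine eventually_all.2 fun i => ?_
      have hs : π (star (x i * E - E * x i)) = 0 := by
        rw [map_star, map_sub, map_mul, map_mul, hE, mul_zero, zero_mul, sub_zero, star_zero]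
      have ha := (hlim (star (x i * E - E * x i) * x i) (by rw [map_mul, hs, zero_mul])).1
      have hb := ((hlim _ hs).1).mul_const (x i)
      have := (ha.sub hb).norm
      rw [sub_self, norm_zero] at this
      refine (this.eventually_lt_const (show (0 : ℝ) < 1 / 2 by norm_num)).mono fun e he => ?_
      rwa [mul_sub, ← mul_assoc, ← mul_assoc]
    obtain ⟨e, ⟨he, hesa, hen⟩, he1, he2⟩ := (hl.and (h1.and h2)).exists
    refine ⟨E + e, by rw [map_add, hE, he, add_zero], hEsa.add hesa, ?_, fun i => ⟨?_, ?_⟩⟩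
    · push_cast
      exact (norm_add_le _ _).trans (add_le_add hEn hen)
    · set S := x i * E - E * x i with hS
      set d := x i * e - e * x i with hd
      have hdn : ‖d‖ ≤ 2 := by
        have h3 : ‖x i * e‖ ≤ 1 * 1 := norm_mul_le_of_le (hx i) hen
        have h4 : ‖e * x i‖ ≤ 1 * 1 := norm_mul_le_of_le hen (hx i)
        linarith [norm_sub_le (x i * e) (e * x i)]
      have hsum : x i * (E + e) - (E + e) * x i = S + d := by rw [hS, hd]; noncomm_ring
      have hsd : ‖star d * S‖ < 1 / 2 := by
        rw [← norm_star, star_mul, star_star]; exact he2 i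
      have h5 : star (S + d) * (S + d) = star S * S + star d * d + star S * d + star d * S := by
        rw [star_add]; noncomm_ring
      rw [hsum, sq, ← CStarRing.norm_star_mul_self, h5]
      have h6 := norm_add₄_le (a := star S * S) (b := star d * d) (c := star S * d) (d := star d * S)
      rw [CStarRing.norm_star_mul_self, CStarRing.norm_star_mul_self] at h6
      have h7 := (hEi i).1
      push_cast
      nlinarith [he2 i, norm_nonneg d]
    · have : (((m + 1 : ℕ) : A) - (E + e)) * y i = ((m : A) - E) * y i + (1 - e) * y i := by
        push_cast; noncomm_ring
      rw [this]
      push_cast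
      linarith [norm_add_le (((m : A) - E) * y i) ((1 - e) * y i), (hEi i).2, he1 i]

theorem exists_ker_almost_commute {A D : Type*} [CStarAlgebra A] [CStarAlgebra D]
    (π : A →⋆ₐ[ℂ] D) {n : ℕ} (x y : Fin n → A) (hx : ∀ i, ‖x i‖ ≤ 1) {η : ℝ} (hη : 0 < η) :
    ∃ e : A, π e = 0 ∧ IsSelfAdjoint e ∧ ‖e‖ ≤ 1 ∧ ∀ i, ‖x i * e - e * x i‖ ≤ η ∧
      ‖(1 - e) * y i‖ ≤ 2 * ‖π (y i)‖ + η := by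
  obtain ⟨m, hm⟩ := exists_nat_gt (5 / η ^ 2)
  have hm0 : (0 : ℝ) < m := lt_of_le_of_lt (by positivity) hm
  obtain ⟨E, hE, hEsa, hEn, hEi⟩ := exists_sum_almost_commute π x y hx hη m
  have hmA : ‖((m : ℝ)⁻¹)‖ = (m : ℝ)⁻¹ := by rw [norm_inv, Real.norm_natCast]
  refine ⟨(m : ℝ)⁻¹ • E, ?_, ?_, ?_, fun i => ⟨?_, ?_⟩⟩
  · have : (m : ℝ)⁻¹ • E = ((m : ℂ)⁻¹) • E := by
      rw [← Complex.coe_smul]; push_cast; rfl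
    rw [this, map_smul, hE, smul_zero]
  · exact (IsSelfAdjoint.all (m : ℝ)⁻¹).smul hEsa
  · rw [norm_smul, hmA, inv_mul_le_iff₀ hm0, mul_one]; exact hEn
  · rw [mul_smul_comm, smul_mul_assoc, ← smul_sub, norm_smul, hmA, inv_mul_le_iff₀ hm0]
    refine (abs_le_of_sq_le_sq' ((hEi i).1.trans ?_) (by positivity)).2
    rw [div_lt_iff₀ (by positivity)] at hm
    nlinarith
  · have : (1 - (m : ℝ)⁻¹ • E) * y i = (m : ℝ)⁻¹ • (((m : A) - E) * y i) := by
      have hmm : (m : A) = (m : ℝ) • (1 : A) := by rw [Nat.cast_smul_eq_nsmul, nsmul_one]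
      rw [← smul_mul_assoc, smul_sub, hmm, smul_smul, inv_mul_cancel₀ hm0.ne', one_smul]
    rw [this, norm_smul, hmA, inv_mul_le_iff₀ hm0]
    exact (hEi i).2

theorem IsSelfAdjoint.exists_lift_almost_commute {A D : Type*} [CStarAlgebra A] [CStarAlgebra D]
    {π : A →⋆ₐ[ℂ] D} (hπ : Function.Surjective π) {n : ℕ} {x : Fin n → A} (hx : ∀ i, ‖x i‖ ≤ 1)
    {h : D} (hh : IsSelfAdjoint h) {δ η : ℝ} (hη : 0 < η)
    (hδ : ∀ i, ‖π (x i) * h - h * π (x i)‖ ≤ δ) :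
    ∃ H : A, IsSelfAdjoint H ∧ π H = h ∧ ∀ i, ‖x i * H - H * x i‖ ≤ 4 * δ + η := by
  obtain ⟨K, hK, hKsa⟩ : ∃ K : A, π K = h ∧ IsSelfAdjoint K := by
    obtain ⟨K, rfl⟩ := hπ h
    refine ⟨realPart K, ?_, (realPart K).2⟩
    rw [realPart_apply_coe, ← Complex.coe_smul, map_smul, map_add, map_star, hh.star_eq,
      ← two_smul ℂ, smul_smul]
    norm_num
  have hpos : 0 < 2 + 4 * ‖K‖ := by positivity
  obtain ⟨e, he, hesa, hen, hei⟩ := exists_ker_almost_commute π x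
    (fun i => x i * K - K * x i) hx (div_pos hη hpos)
  set η' := η / (2 + 4 * ‖K‖) with hη'
  have hηη : η' * (2 + 4 * ‖K‖) = η := div_mul_cancel₀ _ hpos.ne'
  have h2 : ‖1 - e‖ ≤ 2 := by
    have : ‖(1 : A)‖ ≤ 1 := by
      nontriviality A
      exact CStarRing.norm_one.le
    linarith [norm_sub_le (1 : A) e]
  have hst : star (1 - e) = 1 - e := by rw [star_sub, star_one, hesa.star_eq]
  refine ⟨(1 - e) * K * (1 - e), ?_, by simp [he, hK], fun i => ?_⟩
  · rw [IsSelfAdjoint, star_mul, star_mul, hst, hKsa.star_eq, mul_assoc]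
  · obtain ⟨h3, h4⟩ := hei i
    have h5 : π (x i * K - K * x i) = π (x i) * h - h * π (x i) := by simp [hK]
    rw [h5] at h4
    have h6 : x i * ((1 - e) * K * (1 - e)) - (1 - e) * K * (1 - e) * x i =
        (1 - e) * (x i * K - K * x i) * (1 - e) - (x i * e - e * x i) * K * (1 - e)
          - (1 - e) * K * (x i * e - e * x i) := by noncomm_ring
    have h7 : ‖(1 - e) * (x i * K - K * x i) * (1 - e)‖ ≤ (2 * δ + η') * 2 :=
      norm_mul_le_of_le (h4.trans (by linarith [hδ i])) h2
    have h8 : ‖(x i * e - e * x i) * K * (1 - e)‖ ≤ η' * ‖K‖ * 2 :=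
      norm_mul_le_of_le (norm_mul_le_of_le h3 le_rfl) h2
    have h9 : ‖(1 - e) * K * (x i * e - e * x i)‖ ≤ 2 * ‖K‖ * η' :=
      norm_mul_le_of_le (norm_mul_le_of_le h2 le_rfl) h3
    rw [h6]
    refine (norm_sub_le _ _).trans ?_
    linarith [norm_sub_le ((1 - e) * (x i * K - K * x i) * (1 - e))
      ((x i * e - e * x i) * K * (1 - e))]

theorem norm_le_one_of_mem_unitary {A : Type*} [CStarAlgebra A] {v : A} (hv : v ∈ unitary A) :
    ‖v‖ ≤ 1 := by
  nontriviality A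
  exact (CStarRing.norm_of_mem_unitary hv).le

theorem isUnit_one_sub_I_smul {A : Type*} [CStarAlgebra A] {H : A} (hH : IsSelfAdjoint H) :
    IsUnit (1 - Complex.I • H) := by
  have h1 : -Complex.I ∉ spectrum ℂ H := fun h => by
    have := congrArg Complex.im (hH.mem_spectrum_eq_re h)
    simp at this
  have h2 : 1 - Complex.I • H = Complex.I • (algebraMap ℂ A (-Complex.I) - H) := by
    rw [smul_sub, Algebra.algebraMap_eq_smul_one, smul_smul]
    simp
  rw [h2]
  exact (spectrum.notMem_iff.1 h1).smul (Units.mk0 Complex.I Complex.I_ne_zero)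

theorem exists_unitary_lift_almost_commute {A D : Type*} [CStarAlgebra A] [CStarAlgebra D]
    {π : A →⋆ₐ[ℂ] D} (hπ : Function.Surjective π) {n : ℕ} {x : Fin n → A} (hx : ∀ i, ‖x i‖ ≤ 1)
    {w : D} (hw : w ∈ unitary D) (hw1 : ‖w - 1‖ ≤ 1) {δ : ℝ} (hδ0 : 0 < δ)
    (hδ : ∀ i, ‖π (x i) * w - w * π (x i)‖ ≤ δ) :
    ∃ V ∈ unitary A, π V = w ∧ ∀ i, ‖x i * V - V * x i‖ ≤ 18 * δ := by
  have hunit : IsUnit (1 + w) := by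
    have h1 : 1 + w = (2 : ℂ) • (1 - (-(1 / 2 : ℂ)) • (w - 1)) := by module
    have h2 : ‖(-(1 / 2 : ℂ)) • (w - 1)‖ < 1 := by
      rw [norm_smul]; norm_num; linarith
    rw [h1]
    exact (isUnit_one_sub_of_norm_lt_one h2).smul (Units.mk0 (2 : ℂ) two_ne_zero)
  obtain ⟨⟨a, y, hay, hya⟩, rfl : a = 1 + w⟩ := hunit
  have hyw : w * y = 1 - y := by rw [← hay]; noncomm_ring
  have hyw' : y * w = 1 - y := by rw [← hya]; noncomm_ring
  have hyst : star y = 1 - y := by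
    have h1 : star y * (1 + star w) = 1 := by
      rw [← star_one, ← star_add, ← star_mul, hay]
    have h2 : (1 + star w) * (w * y) = 1 := by
      rw [add_mul, one_mul, ← mul_assoc, (Unitary.mem_iff.1 hw).1, ← add_mul, add_comm, hay]
    rw [← hyw]
    exact left_inv_eq_right_inv h1 h2
  have hyn : ‖y‖ ≤ 1 := by
    have h1 : (2 : ℝ) • y = 1 - y * (w - 1) := by
      rw [mul_sub, hyw', two_smul]; noncomm_ring
    have h2 : 2 * ‖y‖ ≤ ‖(1 : D)‖ + ‖y‖ * 1 := by
      calc 2 * ‖y‖ = ‖(2 : ℝ) • y‖ := by rw [norm_smul]; norm_num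
        _ ≤ ‖(1 : D)‖ + ‖y * (w - 1)‖ := h1 ▸ norm_sub_le _ _
        _ ≤ _ := by gcongr; exact norm_mul_le_of_le le_rfl hw1
    linarith [norm_le_one_of_mem_unitary (one_mem (unitary D))]
  set h : D := Complex.I • ((2 : ℂ) • y - 1) with hh
  have hsa : IsSelfAdjoint h := by
    rw [IsSelfAdjoint, hh, star_smul, star_sub, star_smul, hyst]
    simp only [RCLike.star_def, Complex.conj_I, star_one, map_ofNat]
    module
  have hcomm (i) : ‖π (x i) * h - h * π (x i)‖ ≤ 2 * δ := by
    have h1 : π (x i) * h - h * π (x i) =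
        (-(Complex.I * 2)) • (y * (π (x i) * w - w * π (x i)) * y) := by
      have h2 : y * (π (x i) * w - w * π (x i)) * y = y * π (x i) - π (x i) * y := by
        calc _ = y * π (x i) * (w * y) - y * w * π (x i) * y := by noncomm_ring
          _ = _ := by rw [hyw, hyw']; noncomm_ring
      rw [h2, hh, mul_smul_comm, smul_mul_assoc, ← smul_sub, mul_sub, sub_mul, mul_smul_comm,
        smul_mul_assoc, neg_smul, mul_smul, ← smul_neg, ← smul_neg, neg_sub, smul_sub (2 : ℂ)]
      simp
    rw [h1, norm_smul]
    have h3 : ‖y * (π (x i) * w - w * π (x i)) * y‖ ≤ 1 * δ * 1 :=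
      norm_mul_le_of_le (norm_mul_le_of_le hyn (hδ i)) hyn
    simp only [norm_neg, norm_mul, Complex.norm_I, one_mul, Complex.norm_ofNat]
    linarith
  obtain ⟨H, hHsa, hπH, hHc⟩ := hsa.exists_lift_almost_commute hπ hx hδ0 hcomm
  obtain ⟨⟨b, z, hbz, hzb⟩, rfl : b = 1 - Complex.I • H⟩ := isUnit_one_sub_I_smul hHsa
  have hb : star (1 - Complex.I • H) = 1 + Complex.I • H := by
    rw [star_sub, star_smul, hHsa.star_eq]; simp
  have hzs1 : star z * (1 + Complex.I • H) = 1 := by rw [← hb, ← star_mul, hbz, star_one]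
  have hzs2 : (1 + Complex.I • H) * star z = 1 := by rw [← hb, ← star_mul, hzb, star_one]
  have hI1 : z * (Complex.I • H) = z - 1 := by rw [← hzb]; noncomm_ring
  have hI2 : (Complex.I • H) * z = z - 1 := by rw [← hbz]; noncomm_ring
  have hs1 : z + star z = 2 * (z * star z) := by
    calc z + star z = z * ((1 + Complex.I • H) * star z) + z * (1 - Complex.I • H) * star z := by
          rw [hzs2, hzb, mul_one, one_mul]
      _ = _ := by noncomm_ring
  have hs2 : z + star z = 2 * (star z * z) := by
    calc z + star z = star z * (1 + Complex.I • H) * z + star z * ((1 - Complex.I • H) * z) := by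
          rw [hzs1, hbz, mul_one, one_mul]
      _ = _ := by noncomm_ring
  have hVu : 2 * z - 1 ∈ unitary A := by
    have hst : star (2 * z - 1) = 2 * star z - 1 := by
      rw [two_mul, star_sub, star_add, star_one, two_mul]
    rw [Unitary.mem_iff, hst]
    constructor
    · calc (2 * star z - 1) * (2 * z - 1) = 2 * (2 * (star z * z)) - 2 * (z + star z) + 1 := by
            noncomm_ring
        _ = 1 := by rw [hs2]; noncomm_ring
    · calc (2 * z - 1) * (2 * star z - 1) = 2 * (2 * (z * star z)) - 2 * (z + star z) + 1 := by
            noncomm_ring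
        _ = 1 := by rw [hs1]; noncomm_ring
  have hzn : ‖z‖ ≤ 1 := by
    have h1 : (2 : ℝ) • z = (2 * z - 1) + 1 := by rw [two_smul]; noncomm_ring
    have h2 : 2 * ‖z‖ ≤ 1 + 1 := by
      calc 2 * ‖z‖ = ‖(2 : ℝ) • z‖ := by rw [norm_smul]; norm_num
        _ ≤ ‖2 * z - 1‖ + ‖(1 : A)‖ := h1 ▸ norm_add_le _ _
        _ ≤ 1 + 1 := add_le_add (norm_le_one_of_mem_unitary hVu)
            (norm_le_one_of_mem_unitary (one_mem _))
    linarith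
  refine ⟨2 * z - 1, hVu, ?_, fun i => ?_⟩
  · have h1 : (1 - Complex.I • h) = 2 * y := by
      rw [hh, smul_smul, Complex.I_mul_I, two_smul, two_mul, neg_one_smul]; abel
    have h2 : π z * (2 * y) = 1 := by
      rw [← h1, ← hπH, ← map_smul, ← map_one π, ← map_sub, ← map_mul, hzb]
    have h3 : 2 * π z = 1 + w := by
      calc 2 * π z = π z * 2 * (y * (1 + w)) := by rw [hya]; noncomm_ring
        _ = π z * (2 * y) * (1 + w) := by noncomm_ring
        _ = 1 + w := by rw [h2, one_mul]
    rw [map_sub, map_mul, map_one, map_ofNat, h3]; noncomm_ring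
  · have h1 : x i * (2 * z - 1) - (2 * z - 1) * x i =
        (2 * Complex.I) • (z * (x i * H - H * x i) * z) := by
      have h2 : z * (x i * (Complex.I • H) - (Complex.I • H) * x i) * z = x i * z - z * x i := by
        calc _ = z * x i * ((Complex.I • H) * z) - z * (Complex.I • H) * x i * z := by noncomm_ring
          _ = _ := by rw [hI1, hI2]; noncomm_ring
      rw [mul_smul, ← smul_mul_assoc Complex.I, ← mul_smul_comm Complex.I, smul_sub,
        ← mul_smul_comm Complex.I, ← smul_mul_assoc Complex.I, h2, two_smul]
      noncomm_ring
    have h3 : ‖z * (x i * H - H * x i) * z‖ ≤ 1 * (4 * (2 * δ) + δ) * 1 :=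
      norm_mul_le_of_le (norm_mul_le_of_le hzn (hHc i)) hzn
    rw [h1, norm_smul]
    simp only [norm_mul, Complex.norm_I, mul_one, Complex.norm_ofNat]
    linarith

theorem Function.surjective_of_approx_preimage {E F : Type*} [NormedAddCommGroup E]
    [CompleteSpace E] [NormedAddCommGroup F] (f : E →+ F) (hf : Continuous f) (c : ℝ)
    (h : ∀ y, ∃ x, ‖y - f x‖ ≤ 1 / 2 * ‖y‖ ∧ ‖x‖ ≤ c * ‖y‖) : Function.Surjective f := by
  choose g hg hgc using h
  intro y
  let r : ℕ → F := fun k => (fun z => z - f (g z))^[k] y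
  have hr (k) : r (k + 1) = r k - f (g (r k)) := Function.iterate_succ_apply' ..
  have hrn (k) : ‖r k‖ ≤ (1 / 2) ^ k * ‖y‖ := by
    induction k with
    | zero => simp [r]
    | succ k ih =>
      rw [hr, pow_succ']
      exact (hg _).trans (by linarith)
  have hc (k) : ‖g (r k)‖ ≤ (|c| * ‖y‖) * (1 / 2) ^ k := by
    calc _ ≤ c * ‖r k‖ := hgc _
      _ ≤ |c| * ((1 / 2) ^ k * ‖y‖) := by gcongr; exacts [le_abs_self c, hrn k]
      _ = _ := by ring
  have hs : Summable fun k => g (r k) :=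
    Summable.of_norm_bounded (summable_geometric_two.mul_left _) hc
  have hsum (k) : f (∑ i ∈ Finset.range k, g (r i)) = y - r k := by
    induction k with
    | zero => simp [r]
    | succ k ih => rw [Finset.sum_range_succ, map_add, ih, hr]; abel
  have h0 : Tendsto r atTop (𝓝 0) := by
    refine squeeze_zero_norm hrn ?_
    simpa using (tendsto_pow_atTop_nhds_zero_of_lt_one (r := (1 / 2 : ℝ)) (by norm_num)
      (by norm_num)).mul_const ‖y‖
  refine ⟨∑' k, g (r k), tendsto_nhds_unique
    ((hf.tendsto _).comp hs.hasSum.tendsto_sum_nat) ?_⟩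
  have := (tendsto_const_nhds (x := y)).sub h0
  rw [sub_zero] at this
  exact this.congr fun k => (hsum k).symm

theorem ContinuousMap.surjective_comp_of_surjective {K E F : Type*} [TopologicalSpace K]
    [CompactSpace K] [T2Space K] [NormedAddCommGroup E] [NormedSpace ℝ E] [CompleteSpace E]
    [NormedAddCommGroup F] [NormedSpace ℝ F] [CompleteSpace F] (f : E →L[ℝ] F)
    (hf : Function.Surjective f) (y : C(K, F)) : ∃ x : C(K, E), ∀ t, f (x t) = y t := by
  obtain ⟨c, hc, hfc⟩ := f.exists_preimage_norm_le hf
  have hsurj : Function.Surjective (f.compLeftContinuous ℝ K : C(K, E) →ₗ[ℝ] C(K, F)) := by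
    refine Function.surjective_of_approx_preimage
      ((f.compLeftContinuous ℝ K : C(K, E) →ₗ[ℝ] C(K, F)) : C(K, E) →+ C(K, F))
      (f.compLeftContinuous ℝ K).continuous c fun y => ?_
    rcases eq_or_ne y 0 with rfl | hy
    · exact ⟨0, by simp⟩
    obtain ⟨g, hg⟩ := exists_continuous_forall_mem_convex_of_local_const
      (t := fun t : K => {e : E | ‖y t - f e‖ ≤ 1 / 2 * ‖y‖} ∩ {e | ‖e‖ ≤ c * ‖y‖})
      (fun t => by
        refine Convex.inter ?_ ?_
        · have := (convex_closedBall (y t) (1 / 2 * ‖y‖)).linear_preimage (f : E →ₗ[ℝ] F)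
          convert this using 1
          ext e
          simp [dist_eq_norm, norm_sub_rev (y t)]
        · convert convex_closedBall (0 : E) (c * ‖y‖) using 1
          ext e
          simp)
      (fun t => by
        obtain ⟨e, he, hen⟩ := hfc (y t)
        refine ⟨e, ?_⟩
        have hpos : 0 < 1 / 2 * ‖y‖ := by positivity
        filter_upwards [(y.continuous.tendsto t).eventually (Metric.ball_mem_nhds _ hpos)] with s hs
        refine ⟨?_, hen.trans (by gcongr; exact y.norm_coe_le_norm t)⟩
        rw [Set.mem_ofPred_eq, he, ← dist_eq_norm]
        exact (Metric.mem_ball.1 hs).le)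
    exact ⟨g, (ContinuousMap.norm_le _ (by positivity)).2 fun t => (hg t).1,
      (ContinuousMap.norm_le _ (by positivity)).2 fun t => (hg t).2⟩
  obtain ⟨x, hx⟩ := hsurj y
  exact ⟨x, fun t => DFunLike.congr_fun hx t⟩

/-- The commutator of `x` with `v⁻¹ * w` is controlled by the commutators with `v` and `w`. -/
theorem norm_commutator_star_mul_le {D : Type*} [CStarAlgebra D] {v w x : D} (hv : v ∈ unitary D)
    (hw : w ∈ unitary D) {δ : ℝ} (h1 : ‖x * v - v * x‖ ≤ δ) (h2 : ‖x * w - w * x‖ ≤ δ) :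
    ‖x * (star v * w) - star v * w * x‖ ≤ 2 * δ := by
  obtain ⟨hv1, hv2⟩ := Unitary.mem_iff.1 hv
  have h3 : x * (star v * w) - star v * w * x =
      star v * (x * w - w * x) - star v * (x * v - v * x) * (star v * w) := by
    calc _ = star v * (x * w - w * x) - (star v * x * w - x * (star v * w)) := by noncomm_ring
      _ = star v * (x * w - w * x) -
          (star v * x * (v * star v) * w - (star v * v) * x * (star v * w)) := by
        rw [hv1, hv2]; noncomm_ring
      _ = _ := by noncomm_ring
  have h4 : ‖star v‖ ≤ 1 := norm_le_one_of_mem_unitary (Unitary.star_mem hv)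
  have h5 : ‖star v * (x * w - w * x)‖ ≤ 1 * δ := norm_mul_le_of_le h4 h2
  have h6 : ‖star v * (x * v - v * x) * (star v * w)‖ ≤ 1 * δ * (1 * 1) :=
    norm_mul_le_of_le (norm_mul_le_of_le h4 h1)
      (norm_mul_le_of_le h4 (norm_le_one_of_mem_unitary hw))
  rw [h3]
  linarith [norm_sub_le (star v * (x * w - w * x)) (star v * (x * v - v * x) * (star v * w))]

theorem exists_path_lift_of_norm_sub_le_one {K B C : Type*} [TopologicalSpace K] [CompactSpace K]
    [T2Space K] [CStarAlgebra B] [CStarAlgebra C] {π : B →⋆ₐ[ℂ] C}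
    (hπ : Function.Surjective π) {n : ℕ} {x : Fin n → B} (hx : ∀ i, ‖x i‖ ≤ 1) (w : C(K, C))
    (hw : ∀ t, w t ∈ unitary C) (hw1 : ∀ t, ‖w t - 1‖ ≤ 1) {δ : ℝ} (hδ0 : 0 < δ)
    (hδ : ∀ i t, ‖π (x i) * w t - w t * π (x i)‖ ≤ δ) :
    ∃ V : C(K, B), (∀ t, V t ∈ unitary B) ∧ (∀ t, π (V t) = w t) ∧
      ∀ i t, ‖x i * V t - V t * x i‖ ≤ 18 * δ := by
  have hcont : Continuous π := (NonUnitalStarAlgHom.instContinuousLinearMapClassComplex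
    (F := B →⋆ₐ[ℂ] C)).map_continuous π
  have hsurj : Function.Surjective (ContinuousMap.compStarAlgHom K π hcont) := fun y => by
    obtain ⟨z, hz⟩ := ContinuousMap.surjective_comp_of_surjective
      ((⟨π.toAlgHom.toLinearMap, hcont⟩ : B →L[ℂ] C).restrictScalars ℝ) hπ y
    exact ⟨z, ContinuousMap.ext hz⟩
  obtain ⟨V, hV, hVw, hVx⟩ := exists_unitary_lift_almost_commute hsurj
    (x := fun i => ContinuousMap.const K (x i)) (w := w) (δ := δ)
    (fun i => (ContinuousMap.norm_le _ zero_le_one).2 fun t => hx i)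
    (Unitary.mem_iff.2 ⟨ContinuousMap.ext fun t => (Unitary.mem_iff.1 (hw t)).1,
      ContinuousMap.ext fun t => (Unitary.mem_iff.1 (hw t)).2⟩)
    ((ContinuousMap.norm_le _ zero_le_one).2 hw1) hδ0
    (fun i => (ContinuousMap.norm_le _ hδ0.le).2 (hδ i))
  have hV' := Unitary.mem_iff.1 hV
  exact ⟨V, fun t => Unitary.mem_iff.2 ⟨DFunLike.congr_fun hV'.1 t, DFunLike.congr_fun hV'.2 t⟩,
    fun t => DFunLike.congr_fun hVw t,
    fun i => (ContinuousMap.norm_le _ (by positivity)).1 (hVx i)⟩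

theorem exists_path_lift_of_eVariationOn_le {K B C : Type*} [LinearOrder K] [TopologicalSpace K]
    [OrderTopology K] [DenselyOrdered K] [CompactSpace K] [OrderTop K]
    [CStarAlgebra B] [CStarAlgebra C] {π : B →⋆ₐ[ℂ] C}
    (hπ : Function.Surjective π) {n : ℕ} {x : Fin n → B} (hx : ∀ i, ‖x i‖ ≤ 1) (u : C(K, C))
    (hu : ∀ t, u t ∈ unitary C) {δ : ℝ} (hδ0 : 0 < δ)
    (hδ : ∀ i t, ‖π (x i) * u t - u t * π (x i)‖ ≤ δ) (N : ℕ) (s : K)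
    (hs : eVariationOn u (Set.Ici s) ≤ N) :
    ∃ V : C(K, B), (∀ t, V t ∈ unitary B) ∧ (∀ t, π (V t) = star (u s) * u (max t s)) ∧
      ∀ i t, ‖x i * V t - V t * x i‖ ≤ (N + 1) * (36 * δ) := by
  have piece (s r : K) (hsr : s ≤ r) (h : ∀ t ∈ Set.Icc s r, ‖u t - u s‖ ≤ 1) :
      ∃ V : C(K, B), (∀ t, V t ∈ unitary B) ∧
        (∀ t, π (V t) = star (u s) * u (min (max t s) r)) ∧
        ∀ i t, ‖x i * V t - V t * x i‖ ≤ 36 * δ := by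
    have hcont : Continuous fun t => star (u s) * u (min (max t s) r) := by fun_prop
    obtain ⟨V, hV, hVw, hVx⟩ := exists_path_lift_of_norm_sub_le_one hπ hx (w := ⟨_, hcont⟩)
      (fun t => mul_mem (Unitary.star_mem (hu s)) (hu _))
      (fun t => by
        have h1 : star (u s) * u (min (max t s) r) - 1 =
            star (u s) * (u (min (max t s) r) - u s) := by
          rw [mul_sub, (Unitary.mem_iff.1 (hu s)).1]
        rw [ContinuousMap.coe_mk, h1, ← mul_one (1 : ℝ)]
        exact norm_mul_le_of_le (norm_le_one_of_mem_unitary (Unitary.star_mem (hu s)))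
          (h _ ⟨le_min (le_max_right _ _) hsr, min_le_right _ _⟩))
      (δ := 2 * δ) (by positivity)
      (fun i t => norm_commutator_star_mul_le (hu _) (hu _) (hδ i _) (hδ i _))
    exact ⟨V, hV, hVw, fun i t => (hVx i t).trans (by linarith)⟩
  induction N generalizing s with
  | zero =>
    obtain ⟨V, hV, hVw, hVx⟩ := piece s ⊤ le_top fun t ht => by
      have h1 := (eVariationOn.edist_le u (s := Set.Ici s) ht.1 (Set.self_mem_Ici)).trans hs
      rw [Nat.cast_zero, nonpos_iff_eq_zero, edist_eq_zero] at h1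
      simp [h1]
    exact ⟨V, hV, fun t => by simpa using hVw t, fun i t => by simpa using hVx i t⟩
  | succ N ih =>
    by_cases hfar : ∃ t, s ≤ t ∧ 1 ≤ ‖u t - u s‖
    · have hc : Continuous fun t => ‖u t - u s‖ := by fun_prop
      have hclosed : IsClosed {t | s ≤ t ∧ 1 ≤ ‖u t - u s‖} :=
        isClosed_Ici.inter (isClosed_le continuous_const hc)
      obtain ⟨r, ⟨hsr, hr⟩, hleast⟩ := hclosed.isCompact.exists_isLeast hfar
      have hlt (t : K) (hst : s ≤ t) (htr : t < r) : ‖u t - u s‖ ≤ 1 := by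
        by_contra! hcon
        exact absurd (hleast ⟨hst, hcon.le⟩) (not_le.2 htr)
      have hsr' : s < r := by
        refine lt_of_le_of_ne hsr fun h => ?_
        rw [h, sub_self, norm_zero] at hr
        linarith
      have hr1 : ‖u r - u s‖ ≤ 1 := by
        have := nhdsLT_neBot_of_exists_lt ⟨s, hsr'⟩
        have hlim : Tendsto (fun t => ‖u t - u s‖) (𝓝[<] r) (𝓝 ‖u r - u s‖) :=
          (hc.tendsto r).mono_left nhdsWithin_le_nhds
        refine le_of_tendsto hlim ?_
        filter_upwards [Ico_mem_nhdsLT hsr'] with t ht using hlt t ht.1 ht.2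
      have hvar : eVariationOn u (Set.Ici r) ≤ N := by
        have h1 := eVariationOn.union u (s := Set.Icc s r) (t := Set.Ici r)
          (isGreatest_Icc hsr) isLeast_Ici
        rw [Set.Icc_union_Ici_eq_Ici hsr] at h1
        have h2 : 1 ≤ eVariationOn u (Set.Icc s r) := by
          refine le_trans ?_ (eVariationOn.edist_le u (Set.right_mem_Icc.2 hsr)
            (Set.left_mem_Icc.2 hsr))
          rw [edist_dist, dist_eq_norm, ENNReal.one_le_ofReal]
          exact hr
        rw [h1, Nat.cast_succ, add_comm (N : ENNReal)] at hs
        exact (ENNReal.add_le_add_iff_left ENNReal.one_ne_top).1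
          ((add_le_add_left h2 _).trans hs)
      obtain ⟨V, hV, hVw, hVx⟩ := piece s r hsr fun t ht => by
        rcases ht.2.lt_or_eq with h | rfl
        exacts [hlt t ht.1 h, hr1]
      obtain ⟨W, hW, hWw, hWx⟩ := ih r hvar
      refine ⟨V * W, fun t => mul_mem (hV t) (hW t), fun t => ?_, fun i t => ?_⟩
      · rw [ContinuousMap.mul_apply, map_mul, hVw, hWw]
        rcases le_total t r with h | h
        · rw [max_eq_right h, min_eq_left (max_le h hsr), (Unitary.mem_iff.1 (hu r)).1, mul_one]
        · rw [max_eq_left (hsr.trans h), max_eq_left h, min_eq_right h, ← mul_assoc,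
            mul_assoc (star (u s)), (Unitary.mem_iff.1 (hu r)).2, mul_one]
      · have h1 : x i * (V * W) t - (V * W) t * x i =
            (x i * V t - V t * x i) * W t + V t * (x i * W t - W t * x i) := by
          rw [ContinuousMap.mul_apply]; noncomm_ring
        have h2 : ‖(x i * V t - V t * x i) * W t‖ ≤ 36 * δ * 1 :=
          norm_mul_le_of_le (hVx i t) (norm_le_one_of_mem_unitary (hW t))
        have h3 : ‖V t * (x i * W t - W t * x i)‖ ≤ 1 * ((N + 1) * (36 * δ)) :=
          norm_mul_le_of_le (norm_le_one_of_mem_unitary (hV t)) (hWx i t)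
        rw [h1]
        push_cast
        linarith [norm_add_le ((x i * V t - V t * x i) * W t) (V t * (x i * W t - W t * x i))]
    · push Not at hfar
      obtain ⟨V, hV, hVw, hVx⟩ := piece s ⊤ le_top fun t ht => (hfar t ht.1).le
      refine ⟨V, hV, fun t => by simpa using hVw t, fun i t => (hVx i t).trans ?_⟩
      push_cast
      nlinarith [(Nat.cast_nonneg N : (0 : ℝ) ≤ N)]


/-- Lemma 3.1: approximately central rectifiable paths of unitaries of uniformly bounded
length in a quotient lift to approximately central paths of unitaries, with δ depending
only on L, n and ε. -/
theorem approx_central_unitary_path_lifting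
    (L : ℝ) (hL : 0 < L) (n : ℕ) (ε : ℝ) (hε : 0 < ε) :
    ∃ δ : ℝ, 0 < δ ∧
      ∀ (B C : Type)
        [NormedRing B] [StarRing B] [CStarRing B] [NormedAlgebra ℂ B]
        [CompleteSpace B] [StarModule ℂ B]
        [NormedRing C] [StarRing C] [CStarRing C] [NormedAlgebra ℂ C]
        [CompleteSpace C] [StarModule ℂ C]
        (π : B →⋆ₐ[ℂ] C), Function.Surjective π →
        ∀ (x : Fin n → B), (∀ i, ‖x i‖ ≤ 1) →
        ∀ (u : ℝ → C),
          ContinuousOn u (Set.Icc 0 1) →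
          (∀ t ∈ Set.Icc (0 : ℝ) 1, u t ∈ unitary C) →
          u 0 = 1 →
          eVariationOn u (Set.Icc 0 1) ≤ ENNReal.ofReal L →
          (∀ i, ∀ t ∈ Set.Icc (0 : ℝ) 1, ‖π (x i) * u t - u t * π (x i)‖ < δ) →
          ∃ v : ℝ → B,
            ContinuousOn v (Set.Icc 0 1) ∧
            (∀ t ∈ Set.Icc (0 : ℝ) 1, v t ∈ unitary B) ∧
            (∀ t ∈ Set.Icc (0 : ℝ) 1, π (v t) = u t) ∧
            (∀ i, ∀ t ∈ Set.Icc (0 : ℝ) 1, ‖x i * v t - v t * x i‖ < ε) := by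
  obtain ⟨N, hN⟩ := exists_nat_ge L
  refine ⟨ε / (2 * ((N + 1) * 36)), by positivity, ?_⟩
  intro B C _ _ _ _ _ _ _ _ _ _ _ _ π hπ x hx u hu huu hu0 hvar hδ
  let _ : CStarAlgebra B := {}
  let _ : CStarAlgebra C := {}
  have hvar' : eVariationOn (fun t : Set.Icc (0 : ℝ) 1 => u t) (Set.Ici 0) ≤ N := by
    refine (eVariationOn.comp_le_of_monotoneOn u Subtype.val
      (fun _ _ _ _ h => h) fun t _ => t.2).trans (hvar.trans ?_)
    rw [← ENNReal.ofReal_natCast]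
    exact ENNReal.ofReal_le_ofReal hN
  obtain ⟨V, hV, hVu, hVx⟩ := exists_path_lift_of_eVariationOn_le hπ hx
    (u := ⟨fun t : Set.Icc (0 : ℝ) 1 => u t, hu.domRestrict⟩) (fun t => huu t t.2)
    (δ := ε / (2 * ((N + 1) * 36))) (by positivity) (fun i t => (hδ i t t.2).le) N 0 hvar'
  have hext (t : ℝ) (ht : t ∈ Set.Icc (0 : ℝ) 1) :
      Set.IccExtend zero_le_one V t = V ⟨t, ht⟩ := Set.IccExtend_of_mem zero_le_one V ht
  refine ⟨Set.IccExtend zero_le_one V, V.continuous.Icc_extend'.continuousOn, fun t ht => ?_,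
    fun t ht => ?_, fun i t ht => ?_⟩
  · rw [hext t ht]
    exact hV _
  · have h0 : max (⟨t, ht⟩ : Set.Icc (0 : ℝ) 1) 0 = ⟨t, ht⟩ := max_eq_left ht.1
    rw [hext t ht, hVu, h0]
    change star (u 0) * u t = u t
    rw [hu0, star_one, one_mul]
  · rw [hext t ht]
    refine (hVx i _).trans_lt ?_
    have h1 : ((N : ℝ) + 1) * (36 * (ε / (2 * ((N + 1) * 36)))) = ε / 2 := by field_simp
    rw [h1]
    linarith
end

section
/- Fix n ∈ ℕ. Let (B_m)_{m ∈ ℕ} and (C_m)_{m ∈ ℕ} be sequences of unital C*-algebras and π_m : B_m → C_m surjective unital *-homomorphisms. For each m, let x_1^{(m)}, …, x_n^{(m)} ∈ B_m be selfadjoint contractions. Let (c_m)_{m ∈ ℕ} be a bounded sequence with c_m ∈ C_m for each m, such that for each i = 1, …, n one has ‖c_m · π_m(x_i^{(m)}) − π_m(x_i^{(m)}) · c_m‖ → 0 as m → ∞. Then there exists a bounded sequence (b_m)_{m ∈ ℕ} with b_m ∈ B_m and π_m(b_m) = c_m for all m, such that for each i = 1, …, n one has ‖b_m · x_i^{(m)}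 − x_i^{(m)} · b_m‖ → 0 as m → ∞. -/
section CStarLifting

open Filter Topology
open scoped ComplexStarModule CStarAlgebra

variable {A B : Type*} [CStarAlgebra A] [CStarAlgebra B]

/-- The kernel of a *-homomorphism of C⋆-algebras admits a selfadjoint contractive two-sided
approximate unit, given as a filter on the ambient algebra. -/
theorem StarAlgHom.exists_approximateUnit_ker (φ : A →⋆ₐ[ℂ] B) :
    ∃ l : Filter A, l.NeBot ∧ (∀ᶠ e in l, φ e = 0 ∧ IsSelfAdjoint e ∧ ‖e‖ ≤ 1) ∧
      ∀ a, φ a = 0 → Tendsto (fun e ↦ ‖a - e * a‖) l (𝓝 0) ∧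
        Tendsto (fun e ↦ ‖a - a * e‖) l (𝓝 0) := by
  let I : NonUnitalStarSubalgebra ℂ A :=
    NonUnitalStarSubalgebra.comap (φ : A →⋆ₙₐ[ℂ] B) ⊥
  have mem_I (a : A) : a ∈ I ↔ φ a = 0 := by
    simp [I, NonUnitalStarSubalgebra.mem_comap, NonUnitalStarAlgebra.mem_bot]
  have hφ : Continuous φ := map_continuous φ
  have hI : IsClosed (I : Set A) := by
    have : (I : Set A) = φ ⁻¹' {0} := by ext a; simp [mem_I]
    rw [this]
    exact isClosed_singleton.preimage hφ
  let : NonUnitalCStarAlgebra I := NonUnitalStarSubalgebra.nonUnitalCStarAlgebra I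
  let : PartialOrder I := CStarAlgebra.spectralOrder I
  let : StarOrderedRing I := CStarAlgebra.spectralOrderedRing I
  have hl := CStarAlgebra.increasingApproximateUnit (A := I)
  have := hl.neBot
  refine ⟨(CStarAlgebra.approximateUnit I).map ((↑) : I → A), inferInstance, ?_, fun a ha ↦ ?_⟩
  · rw [eventually_map]
    filter_upwards [hl.eventually_norm, hl.eventually_isSelfAdjoint] with e he he'
    exact ⟨(mem_I _).1 e.2, congrArg ((↑) : I → A) he', he⟩
  · have hl₁ := (hl.tendsto_mul_right ⟨a, (mem_I a).2 ha⟩).const_sub ⟨a, (mem_I a).2 ha⟩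
    have hl₂ := (hl.tendsto_mul_left ⟨a, (mem_I a).2 ha⟩).const_sub ⟨a, (mem_I a).2 ha⟩
    rw [sub_self] at hl₁ hl₂
    rw [tendsto_map'_iff, tendsto_map'_iff]
    exact ⟨by simpa using! hl₁.norm, by simpa using! hl₂.norm⟩

/-- Sums of `N` elements of an approximate unit of the kernel of a *-homomorphism can be chosen
so that their commutators with finitely many contractions grow only like `√N`. -/
theorem StarAlgHom.exists_ker_norm_commutator_sq_le {ι : Type*} [Finite ι] (φ : A →⋆ₐ[ℂ] B)
    {x a : ι → A} (hx : ∀ i, ‖x i‖ ≤ 1) (ha : ∀ i, φ (a i) = 0) {ε : ℝ} (hε : 0 < ε) (N : ℕ) :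
    ∃ T : A, φ T = 0 ∧ ‖T‖ ≤ N ∧ (∀ i, ‖(N : ℂ) • a i - a i * T‖ ≤ N * ε) ∧
      ∀ i, ‖T * x i - x i * T‖ ^ 2 ≤ 5 * N := by
  obtain ⟨l, _, hl, hl'⟩ := φ.exists_approximateUnit_ker
  induction N with
  | zero => exact ⟨0, by simp⟩
  | succ N ih =>
    obtain ⟨T, hT, hTN, hTa, hTx⟩ := ih
    set δ : ℝ := 1 / (8 * (N + 1)) with hδ_def
    have hδ : 0 < δ := by positivity
    have hcomm (i) : φ (T * x i - x i * T) = 0 := by simp [hT]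
    obtain ⟨e, ⟨he, he_sa, he_norm⟩, heT⟩ := (hl.and (eventually_all.2 fun i ↦
      (hl' _ (hcomm i)).2.eventually (gt_mem_nhds hδ))).exists
    have hxe (i) : φ (x i * e) = 0 := by simp [he]
    obtain ⟨f, ⟨hf, hf_sa, hf_norm⟩, hfe, hfx, hfa⟩ := (hl.and
      (((hl' e he).1.eventually (gt_mem_nhds hδ)).and
        ((eventually_all.2 fun i ↦ (hl' _ (hxe i)).1.eventually (gt_mem_nhds hδ)).and
          (eventually_all.2 fun i ↦ (hl' _ (ha i)).2.eventually (gt_mem_nhds hε))))).exists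
    refine ⟨T + f, by simp [hT, hf], ?_, fun i ↦ ?_, fun i ↦ ?_⟩
    · push_cast
      exact (norm_add_le _ _).trans (add_le_add hTN hf_norm)
    · have : ((N + 1 : ℕ) : ℂ) • a i - a i * (T + f)
          = ((N : ℂ) • a i - a i * T) + (a i - a i * f) := by
        push_cast
        rw [add_smul, one_smul, mul_add]
        abel
      rw [this]
      push_cast
      linarith [norm_add_le ((N : ℂ) • a i - a i * T) (a i - a i * f), hTa i, hfa i]
    · set S := T * x i - x i * T with hS
      set y := f * x i - x i * f with hy
      have hsum : (T + f) * x i - x i * (T + f) = S + y := by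
        rw [hS, hy]; noncomm_ring
      have norm_comm_le (z : A) : ‖z * x i - x i * z‖ ≤ 2 * ‖z‖ := by
        have h₁ := norm_mul_le_of_le (le_refl ‖z‖) (hx i)
        have h₂ := norm_mul_le_of_le (hx i) (le_refl ‖z‖)
        linarith [norm_sub_le (z * x i) (x i * z)]
      have hS_norm : ‖S‖ ≤ 2 * N := (norm_comm_le T).trans (by gcongr)
      have hy_norm : ‖y‖ ≤ 2 := (norm_comm_le f).trans (by linarith)
      have hye : ‖y * e‖ ≤ 2 * δ := by
        have h : y * e = x i * (e - f * e) - (x i * e - f * (x i * e)) := by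
          rw [hy]; noncomm_ring
        have h₁ : ‖x i * (e - f * e)‖ ≤ 1 * δ := norm_mul_le_of_le (hx i) hfe.le
        rw [h]
        linarith [norm_sub_le (x i * (e - f * e)) (x i * e - f * (x i * e)), hfx i]
      have hSy : ‖S * star y‖ ≤ 1 / 2 := by
        have h : S * star y = (S - S * e) * star y + S * star (y * e) := by
          rw [star_mul, he_sa.star_eq]; noncomm_ring
        have h₁ : ‖(S - S * e) * star y‖ ≤ δ * 2 :=
          norm_mul_le_of_le (heT i).le (by rwa [norm_star])
        have h₂ : ‖S * star (y * e)‖ ≤ 2 * N * (2 * δ) :=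
          norm_mul_le_of_le hS_norm (by rwa [norm_star])
        have h₃ : δ * 2 + 2 * N * (2 * δ) ≤ 1 / 2 := by
          have : δ * (8 * (N + 1)) = 1 := by rw [hδ_def]; field_simp
          nlinarith
        rw [h]
        exact (norm_add_le _ _).trans ((add_le_add h₁ h₂).trans h₃)
      have hyS : ‖y * star S‖ ≤ 1 / 2 := by
        rwa [← norm_star, star_mul, star_star]
      have hexp : (S + y) * star (S + y)
          = (S * star S + y * star y) + (S * star y + y * star S) := by
        rw [star_add]; noncomm_ring
      rw [hsum, pow_two, ← CStarRing.norm_self_mul_star, hexp]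
      have h₁ := norm_add_le (S * star S + y * star y) (S * star y + y * star S)
      have h₂ := norm_add_le (S * star S) (y * star y)
      have h₃ := norm_add_le (S * star y) (y * star S)
      have h₄ := hTx i
      rw [CStarRing.norm_self_mul_star, CStarRing.norm_self_mul_star] at h₂
      push_cast
      nlinarith [norm_nonneg y]

/-- The kernel of a *-homomorphism contains contractions which are approximate right units for
finitely many elements of the kernel and almost commute with finitely many contractions. -/
theorem StarAlgHom.exists_ker_quasicentral {ι : Type*} [Finite ι] (φ : A →⋆ₐ[ℂ] B)
    {x a : ι → A} (hx : ∀ i, ‖x i‖ ≤ 1) (ha : ∀ i, φ (a i) = 0) {ε : ℝ} (hε : 0 < ε) :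
    ∃ e : A, φ e = 0 ∧ ‖e‖ ≤ 1 ∧ (∀ i, ‖a i - a i * e‖ ≤ ε) ∧
      ∀ i, ‖e * x i - x i * e‖ ≤ ε := by
  obtain ⟨N, hN⟩ := exists_nat_gt (5 / ε ^ 2)
  have hN₀ : (0 : ℝ) < N := lt_trans (by positivity) hN
  have hNc : (N : ℂ) ≠ 0 := by exact_mod_cast hN₀.ne'
  obtain ⟨T, hT, hTN, hTa, hTx⟩ := φ.exists_ker_norm_commutator_sq_le hx ha hε N
  have hnorm (z : A) {r : ℝ} (hz : ‖z‖ ≤ N * r) : ‖(N : ℂ)⁻¹ • z‖ ≤ r := by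
    rw [norm_smul, norm_inv, Complex.norm_natCast, inv_mul_le_iff₀ hN₀]
    exact hz
  refine ⟨(N : ℂ)⁻¹ • T, by simp [hT], hnorm T (by simpa using hTN), fun i ↦ ?_, fun i ↦ ?_⟩
  · have : a i - a i * (N : ℂ)⁻¹ • T = (N : ℂ)⁻¹ • ((N : ℂ) • a i - a i * T) := by
      rw [smul_sub, inv_smul_smul₀ hNc, mul_smul_comm]
    rw [this]
    exact hnorm _ (hTa i)
  · rw [smul_mul_assoc, mul_smul_comm, ← smul_sub]
    refine hnorm _ (abs_le_of_sq_le_sq' ((hTx i).trans ?_) (by positivity)).2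
    rw [div_lt_iff₀ (by positivity)] at hN
    nlinarith

/-- A selfadjoint element lifts along a surjective *-homomorphism without increasing its norm. -/
theorem StarAlgHom.exists_lift_isSelfAdjoint_norm_le (φ : A →⋆ₐ[ℂ] B)
    (hφ : Function.Surjective φ) {c : B} (hc : IsSelfAdjoint c) :
    ∃ b : A, φ b = c ∧ ‖b‖ ≤ ‖c‖ := by
  obtain _ | _ := subsingleton_or_nontrivial B
  · exact ⟨0, Subsingleton.elim _ _, by simp⟩
  obtain ⟨b₀, hb₀⟩ := hφ c
  set b : A := (ℜ b₀ : A) with hb_def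
  have hb : IsSelfAdjoint b := (ℜ b₀).2
  have hbc : φ b = c := by
    rw [hb_def, map_realPart, hb₀, hc.coe_realPart]
  let f : ℝ → ℝ := fun t ↦ max (-‖c‖) (min ‖c‖ t)
  have hf : Continuous f := by fun_prop
  refine ⟨cfc f b, ?_, norm_cfc_le (norm_nonneg c) fun t _ ↦ ?_⟩
  · rw [φ.map_cfc (S := ℂ) f b hf.continuousOn (map_continuous φ) hb (by rwa [hbc]), hbc]
    conv_rhs => rw [← cfc_id ℝ c]
    refine cfc_congr fun t ht ↦ ?_
    have := abs_le.1 (spectrum.norm_le_norm_of_mem ht)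
    simp [f, this.1, this.2]
  · rw [Real.norm_eq_abs, abs_le]
    exact ⟨le_max_left _ _, max_le (by linarith [norm_nonneg c]) (min_le_left _ _)⟩

/-- Every element lifts along a surjective *-homomorphism with at most twice its norm. -/
theorem StarAlgHom.exists_lift_norm_le (φ : A →⋆ₐ[ℂ] B) (hφ : Function.Surjective φ) (c : B) :
    ∃ b : A, φ b = c ∧ ‖b‖ ≤ 2 * ‖c‖ := by
  obtain ⟨r, hr, hr'⟩ := φ.exists_lift_isSelfAdjoint_norm_le hφ (ℜ c).2
  obtain ⟨s, hs, hs'⟩ := φ.exists_lift_isSelfAdjoint_norm_le hφ (ℑ c).2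
  refine ⟨r + Complex.I • s, ?_, ?_⟩
  · rw [map_add, map_smul, hr, hs, realPart_add_I_smul_imaginaryPart]
  · have h₁ : ‖(ℜ c : B)‖ ≤ ‖c‖ := realPart.norm_le c
    have h₂ : ‖(ℑ c : B)‖ ≤ ‖c‖ := imaginaryPart.norm_le c
    have h₃ := norm_add_le r (Complex.I • s)
    rw [norm_smul, Complex.norm_I, one_mul] at h₃
    linarith

/-- An element of a quotient lifts to an element whose commutators with finitely many
contractions are controlled by the commutators in the quotient. -/
theorem StarAlgHom.exists_lift_norm_commutator_le {ι : Type*} [Finite ι] (φ : A →⋆ₐ[ℂ] B)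
    (hφ : Function.Surjective φ) {x : ι → A} (hx : ∀ i, ‖x i‖ ≤ 1) (c : B) {ε : ℝ}
    (hε : 0 < ε) :
    ∃ b : A, φ b = c ∧ ‖b‖ ≤ 4 * ‖c‖ ∧
      ∀ i, ‖b * x i - x i * b‖ ≤ 4 * ‖c * φ (x i) - φ (x i) * c‖ + ε := by
  obtain ⟨b, hb, hb_norm⟩ := φ.exists_lift_norm_le hφ c
  choose y hy hy_norm using fun i ↦ φ.exists_lift_norm_le hφ (c * φ (x i) - φ (x i) * c)
  have ha (i) : φ (b * x i - x i * b - y i) = 0 := by simp [hb, hy]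
  have hη : 0 < ε / (1 + 2 * ‖c‖) := by positivity
  obtain ⟨e, he, he_norm, hea, hex⟩ := φ.exists_ker_quasicentral hx ha hη
  have hbe : ‖b * e‖ ≤ 2 * ‖c‖ * 1 := norm_mul_le_of_le hb_norm he_norm
  refine ⟨b - b * e, by simp [hb, he], by linarith [norm_sub_le b (b * e)], fun i ↦ ?_⟩
  set a := b * x i - x i * b - y i with ha_def
  have key : (b - b * e) * x i - x i * (b - b * e)
      = (y i - y i * e) + (a - a * e) - b * (e * x i - x i * e) := by
    rw [ha_def]; noncomm_ring
  have h₁ : ‖y i * e‖ ≤ 2 * ‖c * φ (x i) - φ (x i) * c‖ * 1 :=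
    norm_mul_le_of_le (hy_norm i) he_norm
  have h₂ : ‖b * (e * x i - x i * e)‖ ≤ 2 * ‖c‖ * (ε / (1 + 2 * ‖c‖)) :=
    norm_mul_le_of_le hb_norm (hex i)
  have h₃ : ε / (1 + 2 * ‖c‖) + 2 * ‖c‖ * (ε / (1 + 2 * ‖c‖)) = ε := by
    field_simp
  rw [key]
  linarith [norm_sub_le (y i - y i * e + (a - a * e)) (b * (e * x i - x i * e)),
    norm_add_le (y i - y i * e) (a - a * e), norm_sub_le (y i) (y i * e), hea i, hy_norm i]

end CStarLifting

/-- Asymptotically commuting bounded sequences in quotients lift to asymptotically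
commuting bounded sequences. -/
theorem asymptotically_commuting_lifting
    (n : ℕ)
    (B C : ℕ → Type)
    [∀ m, NormedRing (B m)] [∀ m, StarRing (B m)] [∀ m, CStarRing (B m)]
    [∀ m, NormedAlgebra ℂ (B m)] [∀ m, CompleteSpace (B m)] [∀ m, StarModule ℂ (B m)]
    [∀ m, NormedRing (C m)] [∀ m, StarRing (C m)] [∀ m, CStarRing (C m)]
    [∀ m, NormedAlgebra ℂ (C m)] [∀ m, CompleteSpace (C m)] [∀ m, StarModule ℂ (C m)]
    (π : ∀ m, B m →⋆ₐ[ℂ] C m) (hπ : ∀ m, Function.Surjective (π m))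
    (x : ∀ m, Fin n → B m)
    (hx_sa : ∀ m i, star (x m i) = x m i)
    (hx_contr : ∀ m i, ‖x m i‖ ≤ 1)
    (c : ∀ m, C m)
    (hc_bdd : ∃ M : ℝ, ∀ m, ‖c m‖ ≤ M)
    (hc_comm : ∀ i : Fin n,
      Filter.Tendsto (fun m => ‖c m * (π m) (x m i) - (π m) (x m i) * c m‖)
        Filter.atTop (nhds 0)) :
    ∃ b : ∀ m, B m,
      (∃ M : ℝ, ∀ m, ‖b m‖ ≤ M) ∧
      (∀ m, (π m) (b m) = c m) ∧
      (∀ i : Fin n,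
        Filter.Tendsto (fun m => ‖b m * x m i - x m i * b m‖)
          Filter.atTop (nhds 0)) := by
  let _ : ∀ m, CStarAlgebra (B m) := fun _ ↦ {}
  let _ : ∀ m, CStarAlgebra (C m) := fun _ ↦ {}
  obtain ⟨M, hM⟩ := hc_bdd
  choose b hb hb_norm hb_comm using fun m ↦ (π m).exists_lift_norm_commutator_le (hπ m)
    (hx_contr m) (c m) (Nat.one_div_pos_of_nat (α := ℝ) (n := m))
  refine ⟨b, ⟨4 * M, fun m ↦ (hb_norm m).trans (by linarith [hM m])⟩, hb, fun i ↦ ?_⟩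
  refine squeeze_zero (fun m ↦ norm_nonneg _) (fun m ↦ hb_comm m i) ?_
  simpa using ((hc_comm i).const_mul 4).add
    (tendsto_one_div_add_atTop_nhds_zero_nat (𝕜 := ℝ))
end
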